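/- (Dempster's upper bound MLT ≤ p) Let G be a graph on vertex set {1,…,p} with edge set E, and let n ≥ p be an integer. Then for Lebesgue-almost every X ∈ ℝ^{p×n}, the function K ↦ Tr(X Xᵀ K) − log(det K) attains a minimum on the Gaussian graphical model M_G. -/

import Mathlib

open Matrix MeasureTheory

/-- The Gaussian graphical model of a graph `G`: real symmetric positive definite matrices
whose off-diagonal entries vanish on non-edges of `G`. -/
def gaussianModel {p : ℕ} (G : SimpleGraph (Fin p)) : Set (Matrix (Fin p) (Fin p) ℝ) :=
  {K | K.PosDef ∧ ∀ i j : Fin p, i ≠ j → ¬ G.Adj i j → K i j = 0}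

namespace Matrix

variable {m : Type*} [Fintype m]

lemma PosDef.exists_mul_trace_le_trace_mul [DecidableEq m] {S : Matrix m m ℝ} (hS : S.PosDef) :
    ∃ c > 0, ∀ K : Matrix m m ℝ, K.PosSemidef → c * K.trace ≤ (S * K).trace := by
  obtain ⟨c, hc, hle⟩ : ∃ c > 0, ∀ i, c ≤ hS.1.eigenvalues i := by
    cases isEmpty_or_nonempty m
    · exact ⟨1, one_pos, fun i => isEmptyElim i⟩
    · obtain ⟨i, hi⟩ := Finite.exists_min hS.1.eigenvalues
      exact ⟨_, hS.eigenvalues_pos i, hi⟩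
  refine ⟨c, hc, fun K hK => ?_⟩
  set U : Matrix m m ℝ := (hS.1.eigenvectorUnitary : Matrix m m ℝ) with hU
  have hUU : U * Uᴴ = 1 := Unitary.coe_mul_star_self hS.1.eigenvectorUnitary
  have hspec : S = U * diagonal hS.1.eigenvalues * Uᴴ := by
    conv_lhs => rw [hS.1.spectral_theorem, Unitary.conjStarAlgAut_apply]
    rfl
  have hL : (Uᴴ * K * U).PosSemidef := hK.conjTranspose_mul_mul_same U
  have h1 : K.trace = (Uᴴ * K * U).trace := by
    rw [trace_mul_comm, ← Matrix.mul_assoc, hUU, Matrix.one_mul]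
  have h2 : (S * K).trace = (diagonal hS.1.eigenvalues * (Uᴴ * K * U)).trace := by
    conv_lhs => rw [hspec, Matrix.mul_assoc, Matrix.mul_assoc, trace_mul_comm]
    simp only [Matrix.mul_assoc]
  rw [h1, h2, trace, trace, Finset.mul_sum]
  refine Finset.sum_le_sum fun i _ => ?_
  simp only [diag_apply, diagonal_mul]
  exact mul_le_mul_of_nonneg_right (hle i) hL.diag_nonneg

lemma PosDef.log_det_le [DecidableEq m] {K : Matrix m m ℝ} (hK : K.PosDef) {a : ℝ} (ha : 0 < a) :
    Real.log K.det ≤ a * K.trace - Fintype.card m * (1 + Real.log a) := by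
  rw [hK.1.det_eq_prod_eigenvalues, hK.1.trace_eq_sum_eigenvalues]
  simp only [RCLike.ofReal_real_eq_id, id_eq]
  rw [Real.log_prod fun i _ => (hK.eigenvalues_pos i).ne', Finset.mul_sum]
  calc ∑ i, Real.log (hK.1.eigenvalues i)
      ≤ ∑ i, (a * hK.1.eigenvalues i - (1 + Real.log a)) := by
        refine Finset.sum_le_sum fun i _ => ?_
        have hi := hK.eigenvalues_pos i
        have := Real.log_le_sub_one_of_pos (mul_pos ha hi)
        rw [Real.log_mul ha.ne' hi.ne'] at this
        linarith
    _ = _ := by rw [Finset.sum_sub_distrib, Finset.sum_const, nsmul_eq_mul, Finset.card_univ]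

lemma PosSemidef.abs_apply_le_trace {K : Matrix m m ℝ} (hK : K.PosSemidef) (i j : m) :
    |K i j| ≤ K.trace := by
  classical
  have hd : ∀ k, 0 ≤ K k k := fun k => hK.diag_nonneg
  have hi : ∀ k, K k k ≤ K.trace := fun k =>
    Finset.single_le_sum (f := fun k => K k k) (fun k _ => hd k) (Finset.mem_univ k)
  have hsymm : K j i = K i j := by simpa using hK.1.apply i j
  have hp := hK.dotProduct_mulVec_nonneg (Pi.single i 1 + Pi.single j 1)
  have hm := hK.dotProduct_mulVec_nonneg (Pi.single i 1 - Pi.single j 1)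
  simp [mulVec_add, mulVec_sub, add_dotProduct, sub_dotProduct, hsymm] at hp hm
  have := hi i
  have := hi j
  rw [abs_le]
  constructor <;> linarith

lemma isClosed_setOf_posSemidef : IsClosed {K : Matrix m m ℝ | K.PosSemidef} := by
  simp only [posSemidef_iff_dotProduct_mulVec, IsHermitian, Set.ofPred_and, Set.ofPred_forall]
  refine (isClosed_eq (by fun_prop) continuous_id).inter (isClosed_iInter fun x => ?_)
  exact isClosed_le continuous_const (by fun_prop)

end Matrix

lemma exists_isMinOn_gaussianModel {p : ℕ} (G : SimpleGraph (Fin p))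
    {S : Matrix (Fin p) (Fin p) ℝ} (hS : S.PosDef) :
    ∃ K ∈ gaussianModel G,
      IsMinOn (fun K : Matrix (Fin p) (Fin p) ℝ => (S * K).trace - Real.log K.det)
        (gaussianModel G) K := by
  obtain ⟨c, hc, hcK⟩ := hS.exists_mul_trace_le_trace_mul
  set f : Matrix (Fin p) (Fin p) ℝ → ℝ := fun K => (S * K).trace - Real.log K.det with hf
  set R : ℝ := (f 1 - p * (1 + Real.log (c / 2))) / (c / 2) with hR
  set T : Set (Matrix (Fin p) (Fin p) ℝ) :=
    {K | K.PosSemidef ∧ (∀ i j : Fin p, i ≠ j → ¬ G.Adj i j → K i j = 0) ∧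
      K.trace ≤ R ∧ Real.exp (-f 1) ≤ K.det} with hT
  have hdet : ∀ K ∈ T, 0 < K.det := fun K hK => (Real.exp_pos _).trans_le hK.2.2.2
  have hTM : T ⊆ gaussianModel G := fun K hK =>
    ⟨hK.1.posDef_iff_det_ne_zero.2 (hdet K hK).ne', hK.2.1⟩
  have hsub : ∀ K ∈ gaussianModel G, f K ≤ f 1 → K ∈ T := by
    intro K hK hle
    have h1 := hcK K hK.1.posSemidef
    have h2 := hK.1.log_det_le (half_pos hc)
    have h3 : 0 ≤ K.trace := hK.1.posSemidef.trace_nonneg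
    have h4 : (S * K).trace - Real.log K.det ≤ f 1 := hle
    rw [Fintype.card_fin] at h2
    refine ⟨hK.1.posSemidef, hK.2, ?_, ?_⟩
    · rw [hR, le_div_iff₀ (half_pos hc)]
      linarith
    · rw [← Real.le_log_iff_exp_le hK.1.det_pos]
      nlinarith [mul_nonneg hc.le h3]
  have h1M : (1 : Matrix (Fin p) (Fin p) ℝ) ∈ gaussianModel G :=
    ⟨PosDef.one, fun i j hij _ => one_apply_ne hij⟩
  have h1T := hsub 1 h1M le_rfl
  have hclosed : IsClosed T := by
    have hzero : IsClosed {K : Matrix (Fin p) (Fin p) ℝ |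
        ∀ i j : Fin p, i ≠ j → ¬ G.Adj i j → K i j = 0} := by
      simp only [Set.ofPred_forall]
      exact isClosed_iInter fun i => isClosed_iInter fun j => isClosed_iInter fun _ =>
        isClosed_iInter fun _ => isClosed_eq (by fun_prop) continuous_const
    have htrace : IsClosed {K : Matrix (Fin p) (Fin p) ℝ | K.trace ≤ R} :=
      isClosed_le (by fun_prop) continuous_const
    have hdet : IsClosed {K : Matrix (Fin p) (Fin p) ℝ | Real.exp (-f 1) ≤ K.det} :=
      isClosed_le continuous_const (by fun_prop)
    exact isClosed_setOf_posSemidef.inter (hzero.inter (htrace.inter hdet))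
  have hcompact : IsCompact T := by
    have hbox : IsCompact (Set.univ.pi fun _ : Fin p => Set.univ.pi fun _ : Fin p =>
        Set.Icc (-R) R) :=
      isCompact_univ_pi fun _ => isCompact_univ_pi fun _ => isCompact_Icc
    refine IsCompact.of_isClosed_subset hbox hclosed fun K hK i _ j _ => ?_
    exact abs_le.1 ((hK.1.abs_apply_le_trace i j).trans hK.2.2.1)
  have hcont : ContinuousOn f T :=
    ContinuousOn.sub (Continuous.continuousOn (by fun_prop))
      (ContinuousOn.log (Continuous.continuousOn (by fun_prop)) fun K hK => (hdet K hK).ne')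
  obtain ⟨K, hKT, hK⟩ := hcompact.exists_isMinOn ⟨1, h1T⟩ hcont
  refine ⟨K, hTM hKT, fun L hL => ?_⟩
  rcases le_total (f L) (f 1) with h | h
  · exact hK (hsub L hL h)
  · exact (hK h1T).trans h

lemma ae_det_submatrix_castLE_ne_zero {p n : ℕ} (hn : p ≤ n) :
    ∀ᵐ X : Fin p → Fin n → ℝ, ((Matrix.of X).submatrix id (Fin.castLE hn)).det ≠ 0 := by
  let V : Fin p → Fin n → ℝ := fun i j => if Fin.castLE hn i = j then 1 else 0
  let L : ℝ →ₗ[ℝ] (Fin p → Fin n → ℝ) := LinearMap.toSpanSingleton ℝ _ V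
  have hmeas : MeasurableSet {X : Fin p → Fin n → ℝ |
      ((Matrix.of X).submatrix id (Fin.castLE hn)).det ≠ 0} := by
    refine (isOpen_ne_fun (Continuous.matrix_det ?_) continuous_const).measurableSet
    exact continuous_matrix fun i j => by simp only [submatrix_apply, of_apply]; fun_prop
  refine ae_mem_of_ae_add_linearMap_mem L volume volume hmeas fun Y => ?_
  let A : Matrix (Fin p) (Fin p) ℝ := (Matrix.of Y).submatrix id (Fin.castLE hn)
  have hfin : {t : ℝ | (-A).charpoly.IsRoot t}.Finite :=
    Polynomial.finite_setOfPred_isRoot (charpoly_monic _).ne_zero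
  refine measure_mono_null (fun t ht => ?_) (hfin.measure_zero volume)
  have ht0 : ((Matrix.of (Y + L t)).submatrix id (Fin.castLE hn)).det = 0 := not_not.1 ht
  rw [Set.mem_ofPred_eq, Polynomial.IsRoot, eval_charpoly, ← ht0]
  congr 1
  ext i j
  simp [A, L, V, Matrix.diagonal_apply, add_comm]

lemma posDef_mul_transpose_of_det_submatrix_ne_zero {m k : Type*} [Fintype m] [DecidableEq m]
    [Fintype k] (A : Matrix m k ℝ) (e : m → k) (h : (A.submatrix id e).det ≠ 0) :
    (A * Aᵀ).PosDef := by
  rw [← conjTranspose_eq_transpose_of_trivial]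
  refine PosDef.mul_conjTranspose_self A fun v w hvw => ?_
  refine vecMul_injective_of_isUnit ((isUnit_iff_isUnit_det _).2 h.isUnit) ?_
  funext j
  exact congrFun hvw (e j)

/-- (Dempster's upper bound MLT ≤ p.) If `n ≥ p`, then for almost every
`X ∈ ℝ^{p×n}` the function `K ↦ Tr(X Xᵀ K) − log det K` attains a minimum on
`M_G`. -/
theorem mlt_le_num_vertices (p n : ℕ) (hp : 0 < p) (hn : p ≤ n)
    (G : SimpleGraph (Fin p)) :
    volume {X : Fin p → Fin n → ℝ | ¬ ∃ K ∈ gaussianModel G,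
      IsMinOn (fun K : Matrix (Fin p) (Fin p) ℝ =>
          (Matrix.of X * (Matrix.of X)ᵀ * K).trace - Real.log K.det)
        (gaussianModel G) K} = 0 := by
  rw [← ae_iff]
  filter_upwards [ae_det_submatrix_castLE_ne_zero hn] with X hX
  exact exists_isMinOn_gaussianModel G (posDef_mul_transpose_of_det_submatrix_ne_zero _ _ hX)
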